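/- Let k ≥ 1 be an integer. Then for every s ∈ ℂ with Re(s) > k: Σ_{ℓ≥1} ⌊ℓ^{1/k}⌋^{−s} = Σ_{h=0}^{k−1} binom(k,h)·ζ(s−h), where ⌊ℓ^{1/k}⌋ denotes the floor of the real k-th root of ℓ and ζ is the Riemann zeta function. -/

import Mathlib

open Filter Topology Real

/-- The Piatetski-Shapiro part: `⌊ℓ^κ⌋`. -/
noncomputable def psPart (κ : ℝ) (ℓ : ℕ) : ℕ := ⌊(ℓ : ℝ) ^ κ⌋₊

theorem psPart_one_div_eq_iff {k : ℕ} (hk : k ≠ 0) (n : ℕ) {m : ℕ} (hm : m ≠ 0) :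
    psPart (1 / (k : ℝ)) n = m ↔ m ^ k ≤ n ∧ n < (m + 1) ^ k := by
  have hk' : (0 : ℝ) < k := by exact_mod_cast Nat.pos_of_ne_zero hk
  rw [psPart, Nat.floor_eq_iff' hm, one_div,
    Real.le_rpow_inv_iff_of_pos (Nat.cast_nonneg m) (Nat.cast_nonneg n) hk',
    Real.rpow_inv_lt_iff_of_pos (Nat.cast_nonneg n) (by positivity) hk',
    Real.rpow_natCast, Real.rpow_natCast]
  exact_mod_cast Iff.rfl

theorem psPart_one_div_pos {k n : ℕ} (hn : n ≠ 0) : 0 < psPart (1 / (k : ℝ)) n := by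
  rw [psPart, Nat.floor_pos]
  exact Real.one_le_rpow (by exact_mod_cast Nat.one_le_iff_ne_zero.mpr hn) (by positivity)

/-- Grouping the terms of `∑ F (p i)` according to the value of `p`, whose fibres are finite. -/
theorem tsum_comp_eq_tsum_card_mul {α β : Type*} (p : α → β) (F : β → ℂ) (S : β → Finset α)
    (hS : ∀ b a, a ∈ S b ↔ p a = b) (hF : Summable fun b ↦ ((S b).card : ℂ) * F b) :
    ∑' a, F (p a) = ∑' b, ((S b).card : ℂ) * F b := by
  have hfin (b : β) : Finite {a // p a = b} :=
    Finite.of_injective (fun a : {a // p a = b} ↦ (⟨a.1, (hS b a.1).2 a.2⟩ : S b))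
      fun x y h ↦ Subtype.ext (by simpa using h)
  have hcard (b : β) : Nat.card {a // p a = b} = (S b).card :=
    Nat.subtype_card (S b) (hS b)
  have hsum : Summable fun x : (Σ b, {a // p a = b}) ↦ F x.1 := by
    refine Summable.of_norm ((summable_sigma_of_nonneg fun _ ↦ norm_nonneg _).2
      ⟨fun b ↦ Summable.of_finite, ?_⟩)
    simpa [tsum_const, hcard] using hF.norm
  have key := hsum.tsum_sigma
  rw [← (Equiv.sigmaFiberEquiv p).tsum_eq]
  calc _ = ∑' x : (Σ b, {a // p a = b}), F x.1 :=
        tsum_congr fun x ↦ by simp [Equiv.sigmaFiberEquiv, x.2.2]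
    _ = _ := by rw [key]; simp [tsum_const, hcard]

theorem hasSum_add_one_pow_sub_pow_mul_cpow (k : ℕ) (s : ℂ) (hs : (k : ℝ) < s.re) :
    HasSum (fun m : ℕ ↦ (((m + 2) ^ k - (m + 1) ^ k : ℂ)) * ((m + 1 : ℕ) : ℂ) ^ (-s))
      (∑ h ∈ Finset.range k, (Nat.choose k h : ℂ) * riemannZeta (s - (h : ℂ))) := by
  have hz (h : ℕ) (hh : h ∈ Finset.range k) :
      HasSum (fun m : ℕ ↦ (Nat.choose k h : ℂ) * (1 / (m + 1 : ℂ) ^ (s - h)))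
        ((Nat.choose k h : ℂ) * riemannZeta (s - (h : ℂ))) := by
    have hhk : (h : ℝ) + 1 ≤ k := by exact_mod_cast Finset.mem_range.1 hh
    have hre : 1 < (s - (h : ℂ)).re := by
      rw [Complex.sub_re, Complex.natCast_re]; linarith
    rw [zeta_eq_tsum_one_div_nat_add_one_cpow hre]
    have := (summable_nat_add_iff 1).2 (Complex.summable_one_div_nat_cpow.2 hre)
    exact (Summable.hasSum (by simpa using this)).mul_left _
  refine (hasSum_sum hz).congr_fun ?_
  intro m
  have hm : (m + 1 : ℂ) ≠ 0 := Nat.cast_add_one_ne_zero m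
  have hpow : (m + 2 : ℂ) ^ k - (m + 1) ^ k
      = ∑ h ∈ Finset.range k, (m + 1 : ℂ) ^ h * (Nat.choose k h : ℂ) := by
    rw [show (m + 2 : ℂ) = (m + 1) + 1 by ring, add_pow, Finset.sum_range_succ]
    simp
  rw [hpow, Finset.sum_mul]
  refine Finset.sum_congr rfl fun h _ ↦ ?_
  rw [one_div, ← Complex.cpow_neg, neg_sub, sub_eq_add_neg, Complex.cpow_add _ _ hm,
    Complex.cpow_natCast]
  push_cast
  ring

theorem stmt17 (k : ℕ) (hk : 1 ≤ k) (s : ℂ) (hs : (k : ℝ) < s.re) :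
    ∑' ℓ : ℕ, ((psPart (1 / (k : ℝ)) (ℓ + 1) : ℂ)) ^ (-s) =
      ∑ h ∈ Finset.range k, (Nat.choose k h : ℂ) * riemannZeta (s - (h : ℂ)) := by
  have hpos (ℓ : ℕ) : 0 < psPart (1 / (k : ℝ)) (ℓ + 1) := psPart_one_div_pos ℓ.succ_ne_zero
  set S : ℕ → Finset ℕ := fun m ↦ Finset.Ico ((m + 1) ^ k - 1) ((m + 2) ^ k - 1) with hSdef
  have hS (m ℓ : ℕ) : ℓ ∈ S m ↔ psPart (1 / (k : ℝ)) (ℓ + 1) - 1 = m := by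
    have h1 : 0 < (m + 1) ^ k := by positivity
    have h2 := psPart_one_div_eq_iff (k := k) (by omega) (ℓ + 1) m.succ_ne_zero
    have h3 := hpos ℓ
    simp only [Nat.succ_eq_add_one, add_assoc, Nat.reduceAdd] at h2
    rw [hSdef, Finset.mem_Ico, show psPart (1 / (k : ℝ)) (ℓ + 1) - 1 = m ↔
      psPart (1 / (k : ℝ)) (ℓ + 1) = m + 1 by omega, h2]
    omega
  have hcard (m : ℕ) : ((S m).card : ℂ) = (m + 2) ^ k - (m + 1) ^ k := by
    have h1 : 0 < (m + 1) ^ k := by positivity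
    have h2 : (m + 1) ^ k ≤ (m + 2) ^ k := Nat.pow_le_pow_left (by omega) k
    have h3 : (S m).card = (m + 2) ^ k - (m + 1) ^ k := by
      rw [hSdef, Nat.card_Ico]; omega
    rw [h3, Nat.cast_sub h2]
    push_cast
    rfl
  have hsum := hasSum_add_one_pow_sub_pow_mul_cpow k s hs
  simp only [← hcard] at hsum
  rw [← hsum.tsum_eq, ← tsum_comp_eq_tsum_card_mul
    (fun ℓ ↦ psPart (1 / (k : ℝ)) (ℓ + 1) - 1) (fun m ↦ ((m + 1 : ℕ) : ℂ) ^ (-s)) S hS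
    hsum.summable]
  exact tsum_congr fun ℓ ↦ by rw [Nat.sub_add_cancel (hpos ℓ)]
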